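/- arXiv:2007.01521 — 4 statements merged into one kernel-verified Lean document; each statement's English description precedes it below -/
import Mathlib

section
/- Let d ≥ 2 and let U ⊆ P(d,m) be a color-squarefree monomial order ideal. Put Ũ = {u ∈ U : x_{1,1}·u ∈ U}. Then the link of the vertex 1^{(1)} in Δ_bal(U) equals the simplicial complex generated by the sets F_d(u) \ {(m_1+1)^{(1)}} for u ∈ Ũ; in particular, lk_{Δ_bal(U)}(1^{(1)}) is combinatorially isomorphic to the balanced complex of Ũ regarded as a color-squarefree order ideal in P(d−1,(m_2,…,m_d)). -/
open Finset

noncomputable section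

namespace BalSq

variable {d : ℕ} {m : Fin d → ℕ}

/-- The set of variables `x_{i,j}` of `P(d,m)`: the variable `⟨i,j⟩` has color `i`. -/
abbrev Var (d : ℕ) (m : Fin d → ℕ) : Type := Σ i : Fin d, Fin (m i)

/-- Monomials of `P(d,m)`, encoded as exponent vectors. -/
abbrev Mon (d : ℕ) (m : Fin d → ℕ) : Type := Var d m →₀ ℕ

/-- The vertex set `V = V_1 ∪ ⋯ ∪ V_d`, where `V_i` has `m i + 1` elements;
these are also the variables of `P(d, m + (1,…,1))`. -/
abbrev Vtx (d : ℕ) (m : Fin d → ℕ) : Type := Σ i : Fin d, Fin (m i + 1)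

/-- The monomial `x_{i,j}`. -/
def xvar (i : Fin d) (j : Fin (m i)) : Mon d m := Finsupp.single ⟨i, j⟩ 1

/-- Total degree of a monomial. -/
def deg (u : Mon d m) : ℕ := u.sum fun _ n => n

/-- A monomial is color-squarefree if it is divisible by at most one variable of each color. -/
def ColorSquarefree (u : Mon d m) : Prop :=
  ∀ i : Fin d, (∑ j : Fin (m i), u ⟨i, j⟩) ≤ 1

/-- A color-squarefree monomial order ideal: a finite set of color-squarefree monomials,
closed under divisibility, containing `1` and all the variables. -/
def IsOrderIdeal (U : Finset (Mon d m)) : Prop :=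
  (∀ u ∈ U, ColorSquarefree u) ∧
  (∀ u ∈ U, ∀ v : Mon d m, v ≤ u → v ∈ U) ∧
  ((0 : Mon d m) ∈ U) ∧
  (∀ (i : Fin d) (j : Fin (m i)), xvar i j ∈ U)

/-- The strict order `≺` on variables: `x_{i,j} ≺ x_{k,ℓ}` iff `i < k`, or `i = k` and `j < ℓ`. -/
def vlt (a b : Var d m) : Prop :=
  a.1 < b.1 ∨ (a.1 = b.1 ∧ (a.2 : ℕ) < (b.2 : ℕ))

/-- The vertex of color `i` of the facet `F_d(u)`: the (unique) `j` with `x_{i,j} ∣ u` if it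
exists, and the extra vertex `(m i + 1)^{(i)}` otherwise. -/
def vtxOf (u : Mon d m) (i : Fin d) : Fin (m i + 1) :=
  if h : ∃ j : Fin (m i), u ⟨i, j⟩ ≠ 0 then (Classical.choose h).castSucc else Fin.last (m i)

/-- The facet `F_d(u)` associated to a color-squarefree monomial `u`. -/
def Fd (u : Mon d m) : Finset (Vtx d m) :=
  Finset.univ.image fun i : Fin d => (⟨i, vtxOf u i⟩ : Vtx d m)

/-- The balanced (squeezed) complex `Δ_bal(U)` of a finite set `U` of color-squarefree
monomials: the simplicial complex whose facets are the sets `F_d(u)`, `u ∈ U`. -/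
def Dbal (U : Finset (Mon d m)) : Set (Finset (Vtx d m)) :=
  { F | ∃ u ∈ U, F ⊆ Fd u }

theorem vtxOf_congr {u w : Mon d m} {i : Fin d} (h : ∀ j, u ⟨i, j⟩ = w ⟨i, j⟩) :
    vtxOf u i = vtxOf w i := by
  have h' : (fun j => u ⟨i, j⟩) = fun j => w ⟨i, j⟩ := funext h
  have key : ∀ f g : Fin (m i) → ℕ, f = g →
      (if h : ∃ j : Fin (m i), f j ≠ 0 then (Classical.choose h).castSucc else Fin.last (m i)) =
      (if h : ∃ j : Fin (m i), g j ≠ 0 then (Classical.choose h).castSucc else Fin.last (m i)) := by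
    rintro f g rfl
    rfl
  exact key _ _ h'

theorem csf_unique {u : Mon d m} (hu : ColorSquarefree u) {i : Fin d} {j k : Fin (m i)}
    (hj : u ⟨i, j⟩ ≠ 0) (hk : u ⟨i, k⟩ ≠ 0) : j = k := by
  by_contra hne
  have h1 : ∑ l ∈ ({j, k} : Finset (Fin (m i))), u ⟨i, l⟩ ≤ ∑ l : Fin (m i), u ⟨i, l⟩ :=
    Finset.sum_le_sum_of_subset (Finset.subset_univ _)
  rw [Finset.sum_pair hne] at h1
  have := hu i
  omega

theorem vtxOf_ne_zero {u : Mon d m} {i : Fin d} {j : Fin (m i)}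
    (h : vtxOf u i = j.castSucc) : u ⟨i, j⟩ ≠ 0 := by
  unfold vtxOf at h
  split_ifs at h with hh
  · have h2 := Fin.castSucc_injective _ h
    rw [← h2]
    exact Classical.choose_spec hh
  · exact absurd h.symm (Fin.castSucc_lt_last j).ne

theorem vtxOf_eq {u : Mon d m} (hu : ColorSquarefree u) {i : Fin d} {j : Fin (m i)}
    (h : u ⟨i, j⟩ ≠ 0) : vtxOf u i = j.castSucc := by
  have hh : ∃ j : Fin (m i), u ⟨i, j⟩ ≠ 0 := ⟨j, h⟩
  unfold vtxOf
  rw [dif_pos hh, csf_unique hu (Classical.choose_spec hh) h]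

theorem mem_Fd {u : Mon d m} {i : Fin d} {a : Fin (m i + 1)} :
    (⟨i, a⟩ : Vtx d m) ∈ Fd u ↔ vtxOf u i = a := by
  unfold Fd
  simp only [Finset.mem_image, Finset.mem_univ, true_and]
  constructor
  · rintro ⟨k, hk⟩
    cases hk
    rfl
  · rintro rfl
    exact ⟨i, rfl⟩

theorem xvar_ne {i0 i : Fin d} (hi : i ≠ i0) (j0 : Fin (m i0)) (j : Fin (m i)) :
    xvar i0 j0 ⟨i, j⟩ = 0 := by
  unfold xvar
  apply Finsupp.single_eq_of_ne
  intro h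
  exact hi (congrArg Sigma.fst h)

theorem xvar_self (i0 : Fin d) (j0 : Fin (m i0)) : xvar i0 j0 ⟨i0, j0⟩ = 1 := by
  unfold xvar
  exact Finsupp.single_eq_same

/-- Lemma `lemma:link`.  Let `d ≥ 2`, let `U` be a color-squarefree monomial
order ideal and `Ũ = {u ∈ U : x_{1,1}·u ∈ U}`.  The link of the vertex `1^{(1)}` in
`Δ_bal(U)` is the complex generated by the sets `F_d(u) \ {(m_1+1)^{(1)}}`, `u ∈ Ũ`.
(Here `i0` is the color `1` and `j0` the index of the variable `x_{1,1}`.) -/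
theorem statement_4 (hd : 2 ≤ d) (U : Finset (Mon d m)) (hU : IsOrderIdeal U)
    (i0 : Fin d) (hi0 : (i0 : ℕ) = 0) (j0 : Fin (m i0)) (hj0 : (j0 : ℕ) = 0) :
    { G : Finset (Vtx d m) | (⟨i0, j0.castSucc⟩ : Vtx d m) ∉ G ∧
        insert (⟨i0, j0.castSucc⟩ : Vtx d m) G ∈ Dbal U } =
    { G : Finset (Vtx d m) | ∃ u ∈ U, xvar i0 j0 + u ∈ U ∧
        G ⊆ (Fd u).erase ⟨i0, Fin.last (m i0)⟩ } := by
  ext G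
  simp only [Set.mem_setOf_eq]
  constructor
  · rintro ⟨hG, u, hu, hsub⟩
    have h0 : u ⟨i0, j0⟩ ≠ 0 := vtxOf_ne_zero (mem_Fd.1 (hsub (Finset.mem_insert_self _ _)))
    have hle : xvar i0 j0 ≤ u := by
      unfold xvar
      rw [Finsupp.single_le_iff]
      omega
    refine ⟨u - xvar i0 j0, hU.2.1 u hu _ tsub_le_self, ?_, ?_⟩
    · rw [add_tsub_cancel_of_le hle]
      exact hu
    · rintro ⟨i, a⟩ hg
      have hv := mem_Fd.1 (hsub (Finset.mem_insert_of_mem hg))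
      have hi : i ≠ i0 := by
        rintro rfl
        rw [vtxOf_eq (hU.1 u hu) h0] at hv
        subst hv
        exact hG hg
      refine Finset.mem_erase.2 ⟨fun h => hi (congrArg Sigma.fst h), mem_Fd.2 ?_⟩
      rw [← hv]
      apply vtxOf_congr
      intro j
      rw [Finsupp.tsub_apply, xvar_ne hi, tsub_zero]
  · rintro ⟨u, hu, hw, hsub⟩
    have hcw := hU.1 _ hw
    have hw0 : (xvar i0 j0 + u) ⟨i0, j0⟩ ≠ 0 := by
      rw [Finsupp.add_apply, xvar_self]
      omega
    have hz : ∀ j, u ⟨i0, j⟩ = 0 := by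
      intro j
      by_contra hj
      have hwj : (xvar i0 j0 + u) ⟨i0, j⟩ ≠ 0 := by
        rw [Finsupp.add_apply]
        omega
      have hjj := csf_unique hcw hwj hw0
      subst hjj
      have h1 := Finset.single_le_sum (f := fun l => (xvar i0 j + u) ⟨i0, l⟩)
        (fun _ _ => Nat.zero_le _) (Finset.mem_univ j)
      have h2 := hcw i0
      simp only [Finsupp.add_apply, xvar_self] at h1 h2
      omega
    have hlast : vtxOf u i0 = Fin.last (m i0) := by
      unfold vtxOf
      rw [dif_neg]
      rintro ⟨j, hj⟩
      exact hj (hz j)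
    have hne : ∀ i a, (⟨i, a⟩ : Vtx d m) ∈ G → i ≠ i0 := by
      rintro i a hg rfl
      obtain ⟨h1, h2⟩ := Finset.mem_erase.1 (hsub hg)
      have h3 := mem_Fd.1 h2
      rw [hlast] at h3
      subst h3
      exact h1 rfl
    refine ⟨fun h => hne _ _ h rfl, xvar i0 j0 + u, hw, ?_⟩
    rintro ⟨i, a⟩ hg
    rcases Finset.mem_insert.1 hg with h | h
    · rw [h]
      exact mem_Fd.2 (vtxOf_eq hcw hw0)
    · have hi := hne _ _ h
      rw [mem_Fd, ← mem_Fd.1 (Finset.mem_of_mem_erase (hsub h))]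
      apply vtxOf_congr
      intro j
      rw [Finsupp.add_apply, xvar_ne hi, zero_add]

end BalSq
end
end

section
/- Let U ⊆ P(d,m) be a color-squarefree monomial order ideal. Then for every subset S ⊆ [d], the flag h-vector of the balanced squeezed complex satisfies h_S(Δ_bal(U)) = #{u ∈ U : cSupp(u) = S}. Consequently, for 0 ≤ i ≤ d, h_i(Δ_bal(U)) = #{u ∈ U : deg(u) = i}. -/
open Finset

noncomputable section

namespace BalSq

variable {d : ℕ} {m : Fin d → ℕ}

/-- The color support of a monomial. -/
def cSupp (u : Mon d m) : Finset (Fin d) :=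
  Finset.univ.filter fun i : Fin d => ∃ j : Fin (m i), u ⟨i, j⟩ ≠ 0

/-- The flag `f`-vector: `f_S(Δ)` counts the faces with color set `S`. -/
def flagf (U : Finset (Mon d m)) (S : Finset (Fin d)) : ℕ :=
  Set.ncard {F : Finset (Vtx d m) | F ∈ Dbal U ∧ F.image (fun v => v.1) = S}

/-- The flag `h`-vector: `h_S(Δ) = Σ_{T ⊆ S} (-1)^{#(S\T)} f_T(Δ)`. -/
def flagh (U : Finset (Mon d m)) (S : Finset (Fin d)) : ℤ :=
  ∑ T ∈ S.powerset, (-1 : ℤ) ^ (S.card - T.card) * (flagf U T : ℤ)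

theorem aux_val (u : Mon d m) (hu : ColorSquarefree u) (i : Fin d) (j : Fin (m i)) :
    u ⟨i, j⟩ = if vtxOf u i = j.castSucc then 1 else 0 := by
  classical
  have hle : ∀ j, u ⟨i, j⟩ ≤ 1 := fun j =>
    (Finset.single_le_sum (f := fun j => u ⟨i, j⟩) (fun _ _ => Nat.zero_le _)
      (Finset.mem_univ j)).trans (hu i)
  have huniq : ∀ j k, u ⟨i, j⟩ ≠ 0 → u ⟨i, k⟩ ≠ 0 → j = k := by
    intro j k hj hk
    by_contra hne
    have h1 : ∑ x ∈ ({j, k} : Finset (Fin (m i))), u ⟨i, x⟩ ≤ ∑ x, u ⟨i, x⟩ :=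
      Finset.sum_le_sum_of_subset (Finset.subset_univ _)
    rw [Finset.sum_pair hne] at h1
    have := hu i
    omega
  unfold vtxOf
  split_ifs with h h2 h2
  · have := Classical.choose_spec h
    have e : Classical.choose h = j := Fin.castSucc_injective _ h2
    rw [e] at this
    have := hle j
    omega
  · by_contra h0
    exact h2 (congrArg _ (huniq _ _ (Classical.choose_spec h) h0))
  · exact absurd h2.symm (Fin.castSucc_lt_last j).ne
  · by_contra h0
    exact h ⟨j, h0⟩

theorem aux_congr (u v : Mon d m) (i : Fin d) (h : ∀ j, u ⟨i, j⟩ = v ⟨i, j⟩) :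
    vtxOf u i = vtxOf v i := by
  unfold vtxOf
  have : (fun j => u ⟨i, j⟩ ≠ 0) = (fun j => v ⟨i, j⟩ ≠ 0) := by
    funext j; rw [h j]
  have key : ∀ (p q : Fin (m i) → Prop) (_ : p = q) (h1 : ∃ j, p j) (h2 : ∃ j, q j),
      Classical.choose h1 = Classical.choose h2 := by
    intro p q e h1 h2
    subst e
    rfl
  split_ifs with h1 h2 h2
  · exact congrArg _ (key _ _ this h1 h2)
  · obtain ⟨j, hj⟩ := h1
    exact absurd ⟨j, by rw [← h j]; exact hj⟩ h2
  · obtain ⟨j, hj⟩ := h2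
    exact absurd ⟨j, by rw [h j]; exact hj⟩ h1
  · rfl

def FT (T : Finset (Fin d)) (u : Mon d m) : Finset (Vtx d m) :=
  T.image fun i : Fin d => (⟨i, vtxOf u i⟩ : Vtx d m)

theorem mem_FT (T : Finset (Fin d)) (u : Mon d m) (x : Vtx d m) :
    x ∈ FT T u ↔ x.1 ∈ T ∧ x.2 = vtxOf u x.1 := by
  obtain ⟨i, a⟩ := x
  simp only [FT, Finset.mem_image]
  constructor
  · rintro ⟨k, hk, h⟩
    cases h
    exact ⟨hk, rfl⟩
  · rintro ⟨h1, h2⟩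
    exact ⟨i, h1, by rw [← h2]⟩

theorem flagf_eq (U : Finset (Mon d m)) (hU : IsOrderIdeal U) (T : Finset (Fin d)) :
    flagf U T = (U.filter fun u => cSupp u ⊆ T).card := by
  classical
  have hz : ∀ u : Mon d m, cSupp u ⊆ T → ∀ i, i ∉ T → ∀ j, u ⟨i, j⟩ = 0 := by
    intro u hu i hi j
    by_contra h
    exact hi (hu (by simp only [cSupp, Finset.mem_filter, Finset.mem_univ, true_and]; exact ⟨j, h⟩))
  have hinj : Set.InjOn (FT T) (↑(U.filter fun u => cSupp u ⊆ T) : Set (Mon d m)) := by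
    intro u hu v hv huv
    simp only [Finset.coe_filter, Set.mem_ofPred_eq] at hu hv
    ext ⟨i, j⟩
    by_cases hi : i ∈ T
    · have : (⟨i, vtxOf u i⟩ : Vtx d m) ∈ FT T v := by
        rw [← huv, mem_FT]; exact ⟨hi, rfl⟩
      rw [mem_FT] at this
      have h2 : vtxOf u i = vtxOf v i := this.2
      rw [aux_val u (hU.1 u hu.1), aux_val v (hU.1 v hv.1), h2]
    · rw [hz u hu.2 i hi, hz v hv.2 i hi]
  rw [← Finset.card_image_of_injOn hinj, ← Set.ncard_coe_finset]
  unfold flagf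
  congr 1
  ext F
  simp only [Set.mem_ofPred_eq, Finset.coe_image, Set.mem_image, Finset.coe_filter]
  constructor
  · rintro ⟨⟨u, hu, hF⟩, hT⟩
    have hF' : ∀ x ∈ F, x.2 = vtxOf u x.1 := fun x hx =>
      ((mem_FT Finset.univ u x).1 (hF hx)).2
    let v : Mon d m := u.filter (fun x => x.1 ∈ T)
    have hvT : ∀ i ∈ T, vtxOf v i = vtxOf u i := by
      intro i hi
      apply aux_congr
      intro j
      exact Finsupp.filter_apply_pos _ _ hi
    refine ⟨v, ⟨hU.2.1 u hu v ?_, ?_⟩, ?_⟩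
    · intro x
      by_cases hx : x.1 ∈ T
      · exact (Finsupp.filter_apply_pos (fun x : Var d m => x.1 ∈ T) u hx).le
      · exact (Finsupp.filter_apply_neg (fun x : Var d m => x.1 ∈ T) u hx).trans_le (Nat.zero_le _)
    · intro i hi
      simp only [cSupp, Finset.mem_filter, Finset.mem_univ, true_and] at hi
      obtain ⟨j, hj⟩ := hi
      by_contra hi
      exact hj (Finsupp.filter_apply_neg (fun x : Var d m => x.1 ∈ T) u hi)
    · ext x
      rw [mem_FT]
      constructor
      · rintro ⟨h1, h2⟩
        rw [hvT _ h1] at h2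
        have h3 := h1
        rw [← hT, Finset.mem_image] at h3
        obtain ⟨y, hy, hyx⟩ := h3
        have h4 := hF' y hy
        obtain ⟨i, a⟩ := x
        obtain ⟨k, b⟩ := y
        simp only at hyx h2 h4
        subst hyx
        rw [h2, ← h4]
        exact hy
      · intro hx
        have h1 : x.1 ∈ T := by rw [← hT]; exact Finset.mem_image_of_mem _ hx
        exact ⟨h1, by rw [hvT _ h1]; exact hF' x hx⟩
  · rintro ⟨u, ⟨hu, hc⟩, rfl⟩
    refine ⟨⟨u, hu, Finset.image_subset_image (Finset.subset_univ _)⟩, ?_⟩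
    simp [FT, Finset.image_image, Function.comp_def]

theorem mob (A S : Finset (Fin d)) :
    ∑ T ∈ S.powerset, (-1 : ℤ) ^ (S.card - T.card) * (if A ⊆ T then 1 else 0)
      = if A = S then 1 else 0 := by
  classical
  have h1 : ∑ T ∈ S.powerset, (-1 : ℤ) ^ (S.card - T.card) * (if A ⊆ T then 1 else 0)
      = ∑ R ∈ S.powerset, (-1 : ℤ) ^ R.card * (if A ⊆ S \ R then 1 else 0) := by
    refine Finset.sum_bij' (fun T _ => S \ T) (fun T _ => S \ T) ?_ ?_ ?_ ?_ ?_
    · intro T _; simp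
    · intro T _; simp
    · intro T hT; simpa using hT
    · intro T hT; simpa using hT
    · intro T hT
      rw [Finset.mem_powerset] at hT
      rw [Finset.card_sdiff_of_subset hT, Finset.sdiff_sdiff_eq_self hT]
  rw [h1]
  by_cases hA : A ⊆ S
  · have h2 : ∑ R ∈ S.powerset, (-1 : ℤ) ^ R.card * (if A ⊆ S \ R then 1 else 0)
        = ∑ R ∈ (S \ A).powerset, (-1 : ℤ) ^ R.card := by
      simp only [mul_ite, mul_one, mul_zero]
      rw [← Finset.sum_filter]
      apply Finset.sum_congr _ (fun _ _ => rfl)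
      ext R
      simp only [Finset.mem_filter, Finset.mem_powerset, Finset.subset_sdiff]
      constructor
      · rintro ⟨h, _, h'⟩; exact ⟨h, h'.symm⟩
      · rintro ⟨h, h'⟩; exact ⟨h, hA, h'.symm⟩
    rw [h2, Finset.sum_powerset_neg_one_pow_card]
    congr 1
    rw [Finset.sdiff_eq_empty_iff_subset, eq_iff_iff]
    exact ⟨fun h => hA.antisymm h, fun h => h ▸ Finset.Subset.refl _⟩
  · rw [if_neg (fun h : A = S => hA h.subset)]
    apply Finset.sum_eq_zero
    intro R _
    rw [if_neg (fun h => hA (h.trans Finset.sdiff_subset)), mul_zero]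

theorem flagh_eq (U : Finset (Mon d m)) (hU : IsOrderIdeal U) (S : Finset (Fin d)) :
    flagh U S = ((U.filter fun u => cSupp u = S).card : ℤ) := by
  unfold flagh
  simp only [flagf_eq U hU, Finset.card_filter, Nat.cast_sum, Nat.cast_ite, Nat.cast_one,
    Nat.cast_zero, Finset.mul_sum]
  rw [Finset.sum_comm]
  exact Finset.sum_congr rfl fun u _ => mob _ _

theorem deg_eq (u : Mon d m) (hu : ColorSquarefree u) : deg u = (cSupp u).card := by
  classical
  unfold deg cSupp
  rw [Finsupp.sum_fintype _ _ (fun _ => rfl), Fintype.sum_sigma, Finset.card_filter]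
  apply Finset.sum_congr rfl
  intro i _
  split_ifs with h
  · obtain ⟨j, hj⟩ := h
    have := Finset.single_le_sum (f := fun j => u ⟨i, j⟩) (fun _ _ => Nat.zero_le _)
      (Finset.mem_univ j)
    have h2 := hu i
    omega
  · push Not at h
    exact Finset.sum_eq_zero fun j _ => h j

/-- Corollary `cor:h-vector` and Remark `rem:h-vector`.  For a
color-squarefree monomial order ideal `U` one has
`h_S(Δ_bal(U)) = #{u ∈ U : cSupp u = S}` for all `S ⊆ [d]`, and consequently
`h_i(Δ_bal(U)) = #{u ∈ U : deg u = i}` for `0 ≤ i ≤ d`. -/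
theorem statement_7 (U : Finset (Mon d m)) (hU : IsOrderIdeal U) :
    (∀ S : Finset (Fin d),
      flagh U S = ((U.filter fun u => cSupp u = S).card : ℤ)) ∧
    (∀ i : ℕ, i ≤ d →
      (∑ S ∈ Finset.univ.filter (fun S : Finset (Fin d) => S.card = i), flagh U S)
        = ((U.filter fun u => deg u = i).card : ℤ)) := by
  refine ⟨flagh_eq U hU, fun i _ => ?_⟩
  rw [Finset.sum_congr rfl (fun S _ => flagh_eq U hU S), ← Nat.cast_sum]
  congr 1
  rw [Finset.card_eq_sum_card_fiberwise (f := cSupp)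
    (t := Finset.univ.filter (fun S : Finset (Fin d) => S.card = i))]
  · apply Finset.sum_congr rfl
    intro S hS
    congr 1
    ext u
    simp only [Finset.mem_filter, Finset.mem_univ, true_and] at hS ⊢
    constructor
    · rintro ⟨h1, h2⟩
      exact ⟨⟨h1, by rw [deg_eq u (hU.1 u h1), h2, hS]⟩, h2⟩
    · rintro ⟨⟨h1, _⟩, h2⟩
      exact ⟨h1, h2⟩
  · intro u hu
    simp only [Finset.coe_filter, Set.mem_ofPred_eq, Finset.mem_univ, true_and] at hu ⊢
    rw [← deg_eq u (hU.1 u hu.1)]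
    exact hu.2

end BalSq
end
end

section
/- Let T = K[z_1,…,z_n, y] be a polynomial ring over a field K, let m ≤ n, let I = (z_1,…,z_m), and let I^{[2]} = (z_i z_j : 1 ≤ i < j ≤ m). Then the T-module homomorphism T^m → T/I^{[2]} sending (f_1,…,f_m) to y·Σ_{j=1}^m z_j f_j mod I^{[2]} induces an isomorphism of ℤ^{n+1}-graded T-modules ⊕_{j=1}^m (T/(z_1,…,ẑ_j,…,z_m))(−deg(y z_j)) ≅ (yI + I^{[2]})/I^{[2]}, where ẑ_j means that z_j is omitted from the list of generators. -/
noncomputable section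

namespace Sq15

/-- The variable `z_j` of `T = K[z_1,…,z_n,y]`. -/
def z (K : Type*) [Field K] {n mv : ℕ} (hmn : mv ≤ n) (j : Fin mv) :
    MvPolynomial (Fin (n + 1)) K :=
  MvPolynomial.X ((Fin.castLE hmn j).castSucc)

/-- The variable `y` of `T = K[z_1,…,z_n,y]`. -/
def yv (K : Type*) [Field K] (n : ℕ) : MvPolynomial (Fin (n + 1)) K :=
  MvPolynomial.X (Fin.last n)

/-- Lemma `lem:an iso`.  Let `T = K[z_1,…,z_n,y]`, `m ≤ n`,
`I = (z_1,…,z_m)` and `I^{[2]} = (z_i z_j : i < j ≤ m)`.  The map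
`(f_1,…,f_m) ↦ y·Σ z_j f_j mod I^{[2]}` induces an isomorphism of `ℤ^{n+1}`-graded
`T`-modules `⊕_j (T/(z_1,…,ẑ_j,…,z_m))(-deg(y z_j)) ≅ (yI + I^{[2]})/I^{[2]}`:
it is well defined, injective, and its image is `(yI + I^{[2]})/I^{[2]}`. -/
theorem statement_15 (K : Type*) [Field K] (n mv : ℕ) (hmn : mv ≤ n) :
    (∀ f : Fin mv → MvPolynomial (Fin (n + 1)) K,
      (∀ j, f j ∈ Ideal.span { p | ∃ i : Fin mv, i ≠ j ∧ p = z K hmn i }) →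
      yv K n * ∑ j, z K hmn j * f j ∈
        Ideal.span { p | ∃ i j : Fin mv, i < j ∧ p = z K hmn i * z K hmn j }) ∧
    (∀ f : Fin mv → MvPolynomial (Fin (n + 1)) K,
      yv K n * ∑ j, z K hmn j * f j ∈
        Ideal.span { p | ∃ i j : Fin mv, i < j ∧ p = z K hmn i * z K hmn j } →
      ∀ j, f j ∈ Ideal.span { p | ∃ i : Fin mv, i ≠ j ∧ p = z K hmn i }) ∧
    (∀ f : Fin mv → MvPolynomial (Fin (n + 1)) K,
      yv K n * ∑ j, z K hmn j * f j ∈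
        Ideal.span {yv K n} * Ideal.span { p | ∃ i : Fin mv, p = z K hmn i } ⊔
          Ideal.span { p | ∃ i j : Fin mv, i < j ∧ p = z K hmn i * z K hmn j }) ∧
    (∀ p ∈ Ideal.span {yv K n} * Ideal.span { p | ∃ i : Fin mv, p = z K hmn i } ⊔
        Ideal.span { p | ∃ i j : Fin mv, i < j ∧ p = z K hmn i * z K hmn j },
      ∃ f : Fin mv → MvPolynomial (Fin (n + 1)) K,
        p - yv K n * ∑ j, z K hmn j * f j ∈
          Ideal.span { p | ∃ i j : Fin mv, i < j ∧ p = z K hmn i * z K hmn j }) := by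
  have hzz : ∀ i j : Fin mv, i ≠ j → z K hmn i * z K hmn j ∈
      Ideal.span { p | ∃ i j : Fin mv, i < j ∧ p = z K hmn i * z K hmn j } := by
    intro i j hij
    rcases lt_or_gt_of_ne hij with h | h
    · exact Ideal.subset_span ⟨i, j, h, rfl⟩
    · exact Ideal.subset_span ⟨j, i, h, mul_comm _ _⟩
  refine ⟨?_, ?_, ?_, ?_⟩
  · intro f hf
    refine Ideal.mul_mem_left _ _ (Ideal.sum_mem _ fun j _ => ?_)
    have h := hf j
    generalize f j = q at h ⊢
    induction h using Submodule.span_induction with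
    | mem x hx =>
      obtain ⟨i, hi, rfl⟩ := hx
      exact hzz j i hi.symm
    | zero => simp
    | add a b _ _ ha hb => rw [mul_add]; exact Ideal.add_mem _ ha hb
    | smul a b _ hb =>
      rw [smul_eq_mul, mul_left_comm]; exact Ideal.mul_mem_left _ _ hb
  · intro f hf j
    classical
    let g : Fin (n + 1) → MvPolynomial (Fin (n + 1)) K := fun k =>
      if ∃ i : Fin mv, i ≠ j ∧ k = (Fin.castLE hmn i).castSucc then 0 else MvPolynomial.X k
    let φ := MvPolynomial.aeval (R := K) g
    have hinj : ∀ a b : Fin mv, (Fin.castLE hmn a).castSucc = (Fin.castLE hmn b).castSucc →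
        a = b := by
      intro a b h
      simpa [Fin.ext_iff] using h
    have h0 : ∀ i, i ≠ j → φ (z K hmn i) = 0 := by
      intro i hi
      simp only [φ, z, MvPolynomial.aeval_X, g]
      exact if_pos ⟨i, hi, rfl⟩
    have hj : φ (z K hmn j) = z K hmn j := by
      simp only [φ, z, MvPolynomial.aeval_X, g]
      refine if_neg ?_
      rintro ⟨i, hi, h⟩
      exact hi (hinj _ _ h).symm
    have hy : φ (yv K n) = yv K n := by
      simp only [φ, yv, MvPolynomial.aeval_X, g]
      refine if_neg ?_
      rintro ⟨i, hi, h⟩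
      exact (Fin.castSucc_lt_last _).ne h.symm
    have hker : ∀ p ∈ Ideal.span { p | ∃ i j : Fin mv, i < j ∧ p = z K hmn i * z K hmn j },
        φ p = 0 := by
      intro p hp
      have : Ideal.span { p | ∃ i j : Fin mv, i < j ∧ p = z K hmn i * z K hmn j }
          ≤ RingHom.ker φ := by
        rw [Ideal.span_le]
        rintro _ ⟨a, b, hab, rfl⟩
        rw [SetLike.mem_coe, RingHom.mem_ker, map_mul]
        by_cases ha : a = j
        · rw [h0 b (by rintro rfl; exact hab.ne ha), mul_zero]
        · rw [h0 a ha, zero_mul]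
      exact this hp
    have h1 := hker _ hf
    rw [map_mul, hy, map_sum, Finset.sum_eq_single j
      (fun i _ hi => by rw [map_mul, h0 i hi, zero_mul]) (by simp), map_mul, hj] at h1
    have h2 : φ (f j) = 0 := by
      have hy0 : yv K n ≠ 0 := MvPolynomial.X_ne_zero _
      have hz0 : z K hmn j ≠ 0 := MvPolynomial.X_ne_zero _
      simpa [hy0, hz0] using h1
    set J := Ideal.span { p | ∃ i : Fin mv, i ≠ j ∧ p = z K hmn i } with hJ
    have h3 : (Ideal.Quotient.mkₐ K J).comp φ = Ideal.Quotient.mkₐ K J := by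
      apply MvPolynomial.algHom_ext
      intro k
      simp only [φ, AlgHom.comp_apply, MvPolynomial.aeval_X, g]
      split_ifs with h
      · obtain ⟨i, hi, rfl⟩ := h
        rw [map_zero]
        symm
        exact Ideal.Quotient.eq_zero_iff_mem.2 (Ideal.subset_span ⟨i, hi, rfl⟩)
      · rfl
    have h4 := DFunLike.congr_fun h3 (f j)
    rw [AlgHom.comp_apply, h2, map_zero] at h4
    exact Ideal.Quotient.eq_zero_iff_mem.1 h4.symm
  · intro f
    refine Ideal.mem_sup_left (Ideal.mul_mem_mul (Ideal.mem_span_singleton_self _) ?_)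
    exact Ideal.sum_mem _ fun j _ => Ideal.mul_mem_right _ _ (Ideal.subset_span ⟨j, rfl⟩)
  · intro p hp
    obtain ⟨a, ha, b, hb, rfl⟩ := Submodule.mem_sup.1 hp
    obtain ⟨c, hc, rfl⟩ := Ideal.mem_span_singleton_mul.1 ha
    have hset : { p | ∃ i : Fin mv, p = z K hmn i } = Set.range (z K hmn) := by
      ext p; simp [eq_comm]
    rw [hset] at hc
    obtain ⟨f, rfl⟩ := Ideal.mem_span_range_iff_exists_fun.1 hc
    refine ⟨f, ?_⟩
    have : ∑ i, f i * z K hmn i = ∑ i, z K hmn i * f i :=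
      Finset.sum_congr rfl fun i _ => mul_comm _ _
    rw [this, add_sub_cancel_left]
    exact hb

end Sq15
end
end

section
/- Let P = P(d,m), P' = P(d, m+(1,…,1)), and consider the ideal I = 𝔪_1^{[2]} + ⋯ + 𝔪_d^{[2]} of P'. Then there is an exact sequence of ℤ^{d+|m|}-graded P'-modules 0 → F_d → ⋯ → F_1 → F_0 = P'/I → P'/(I + Σ_{i=1}^d x_{i,m_i+1}·𝔪_i) → 0, where F_k = ⊕_{u ∈ [Mon_cs(P)]_k} (P'/(I : u))(−deg(u·∏_{i ∈ cSupp(u)} x_{i,m_i+1})). -/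
open Finset

noncomputable section

namespace BalSq

variable {d : ℕ} {m : Fin d → ℕ}

variable (K : Type*) [Field K]

/-- The polynomial ring `P(d,m)`. -/
abbrev PR (d : ℕ) (m : Fin d → ℕ) (K : Type*) [Field K] : Type _ :=
  MvPolynomial (Var d m) K

/-- The monomial of `P(d,m)` with exponent vector `u`. -/
def mon (u : Mon d m) : PR d m K := MvPolynomial.monomial u 1

/-- The ideal `I(U)` generated by all monomials of `P(d,m)` not lying in `U`. -/
def IU (U : Finset (Mon d m)) : Ideal (PR d m K) :=
  Ideal.span { p : PR d m K | ∃ u : Mon d m, u ∉ U ∧ p = mon K u }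

/-- The ideal `𝔪_1^2 + ⋯ + 𝔪_d^2` of `P(d,m)`. -/
def sqIdeal : Ideal (PR d m K) :=
  Ideal.span { p : PR d m K | ∃ (i : Fin d) (j k : Fin (m i)),
    p = mon K (xvar i j + xvar i k) }

/-- A monomial ideal is strongly color-stable if `x_{k,ℓ}·u ∈ I` and `j < ℓ` imply
`x_{k,j}·u ∈ I`. -/
def StronglyColorStable (I : Ideal (PR d m K)) : Prop :=
  ∀ (u : Mon d m) (k : Fin d) (l j : Fin (m k)),
    mon K (xvar k l + u) ∈ I → j < l → mon K (xvar k j + u) ∈ I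

/-- Strongly color-stable across colors. -/
def StronglyColorStableAcross (I : Ideal (PR d m K)) : Prop :=
  StronglyColorStable K I ∧
  ∀ (u : Mon d m) (k : Fin d) (l : Fin (m k)) (i : Fin d) (j : Fin (m i)),
    ColorSquarefree (xvar k l + u) → mon K (xvar k l + u) ∈ I →
    vlt ⟨i, j⟩ ⟨k, l⟩ → ColorSquarefree (xvar i j + u) → mon K (xvar i j + u) ∈ I

/-- The minimal monomial generators of a monomial ideal. -/
def MinGens (I : Ideal (PR d m K)) : Set (Mon d m) :=
  { w | mon K w ∈ I ∧ ∀ v : Mon d m, v ≤ w → v ≠ w → mon K v ∉ I }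

/-- The embedding of the variables of `P(d,m)` into those of `P(d, m + (1,…,1))`,
identifying the vertex `j^{(i)}` with the variable `x_{i,j}`. -/
def emb : Var d m → Vtx d m := fun v => ⟨v.1, v.2.castSucc⟩

/-- The polynomial ring `P(d, m + (1,…,1))`. -/
abbrev Pp (d : ℕ) (m : Fin d → ℕ) (K : Type*) [Field K] : Type _ :=
  MvPolynomial (Vtx d m) K

/-- The Stanley-Reisner ideal of a simplicial complex on the vertex set `V`,
generated by the squarefree monomials corresponding to non-faces. -/
def SRIdeal (Δ : Set (Finset (Vtx d m))) : Ideal (Pp d m K) :=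
  Ideal.span { p : Pp d m K | ∃ F : Finset (Vtx d m), F ∉ Δ ∧ p = ∏ v ∈ F, MvPolynomial.X v }

/-- A finite set of variables is color-squarefree if it contains at most one variable of each
color; such sets correspond to the color-squarefree monomials of `P(d,m)`. -/
def CSFSet (A : Finset (Var d m)) : Prop :=
  ∀ v ∈ A, ∀ w ∈ A, v.1 = w.1 → v = w

/-- The color-squarefree monomial of `P(d, m + (1,…,1))` corresponding to `A`. -/
def monA (A : Finset (Var d m)) : Pp d m K :=
  MvPolynomial.monomial (∑ v ∈ A, Finsupp.single (emb v) 1) 1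

/-- The ideal `𝔪_1^{[2]} + ⋯ + 𝔪_d^{[2]}` of `P(d, m + (1,…,1))`. -/
def brIdeal : Ideal (Pp d m K) :=
  Ideal.span { p : Pp d m K | ∃ (i : Fin d) (j k : Fin (m i)), j < k ∧
    p = MvPolynomial.X (⟨i, j.castSucc⟩ : Vtx d m) * MvPolynomial.X (⟨i, k.castSucc⟩ : Vtx d m) }

/-- The ideal `Σ_{i=1}^d x_{i,m_i+1}·𝔪_i` of `P(d, m + (1,…,1))`. -/
def lastIdeal : Ideal (Pp d m K) :=
  Ideal.span { p : Pp d m K | ∃ (i : Fin d) (j : Fin (m i)),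
    p = MvPolynomial.X (⟨i, Fin.last (m i)⟩ : Vtx d m) *
        MvPolynomial.X (⟨i, j.castSucc⟩ : Vtx d m) }

/-- The degree of `u·∏_{i ∈ cSupp u} x_{i,m_i+1}`, for the color-squarefree monomial `u`
with support `A`. -/
def shiftDeg (A : Finset (Var d m)) : Vtx d m →₀ ℕ :=
  ∑ v ∈ A, (Finsupp.single (emb v) 1 +
    Finsupp.single (⟨v.1, Fin.last (m v.1)⟩ : Vtx d m) 1)

/-- The colon ideal `(I : u)`, where `u` is the color-squarefree monomial with support `A`. -/
def colonOf (I : Ideal (Pp d m K)) (A : Finset (Var d m)) : Ideal (Pp d m K) :=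
  Submodule.colon (I : Submodule (Pp d m K) (Pp d m K)) (Ideal.span {monA K A})

/-- The index set `[Mon_cs(P)]_k` of color-squarefree monomials of degree `k`, encoded by
their supports. -/
abbrev CSFk (d : ℕ) (m : Fin d → ℕ) (k : ℕ) : Type _ :=
  {A : Finset (Var d m) // CSFSet A ∧ A.card = k}

/-- The module `F_k = ⊕_{u ∈ [Mon_cs(P)]_k} P'/(I : u)`. -/
abbrev FmodC (I : Ideal (Pp d m K)) (k : ℕ) : Type _ :=
  ∀ A : CSFk d m k, Pp d m K ⧸ colonOf K I A.1

/-- A `P'`-linear map `P'/N₁ → P'/N₂` is graded of degree `0` with respect to the shifts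
`s₁`, `s₂` (source shifted by `-s₁`, target by `-s₂`) iff it is induced by multiplication
with a homogeneous polynomial of degree `s₁ - s₂`. -/
def GradedBetween (N₁ N₂ : Ideal (Pp d m K)) (s₁ s₂ : Vtx d m →₀ ℕ)
    (g : (Pp d m K ⧸ N₁) →ₗ[Pp d m K] Pp d m K ⧸ N₂) : Prop :=
  ∃ p : Pp d m K, (∀ μ : Vtx d m →₀ ℕ, MvPolynomial.coeff μ p ≠ 0 → μ + s₂ = s₁) ∧
    ∀ x : Pp d m K, g (Submodule.Quotient.mk x) = Submodule.Quotient.mk (p * x)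

/-- The component of a linear map between direct sums (products). -/
def piComp {R : Type*} [CommRing R] {ι₁ ι₂ : Type*} [DecidableEq ι₁]
    {M₁ : ι₁ → Type*} {M₂ : ι₂ → Type*}
    [∀ i, AddCommGroup (M₁ i)] [∀ i, Module R (M₁ i)]
    [∀ i, AddCommGroup (M₂ i)] [∀ i, Module R (M₂ i)]
    (f : (∀ i, M₁ i) →ₗ[R] ∀ i, M₂ i) (a : ι₁) (b : ι₂) : M₁ a →ₗ[R] M₂ b :=
  (LinearMap.proj b) ∘ₗ f ∘ₗ (LinearMap.single R M₁ a)

/-- The extension of the ideal `I ⊆ P(d,m)` to `P(d, m + (1,…,1))`, plus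
`𝔪_1^{[2]} + ⋯ + 𝔪_d^{[2]}`; this is the ideal `I'`. -/
def extBr (I : Ideal (PR d m K)) : Ideal (Pp d m K) :=
  Ideal.map (MvPolynomial.rename (emb : Var d m → Vtx d m)) I ⊔ brIdeal K

section chain

variable {V : Type*} [Fintype V] [DecidableEq V] {R : Type*} [CommRing R]

def sg (e : V → ℕ) (v : V) (B : Finset V) : R := (-1) ^ (B.filter (fun a => e a < e v)).card

def DD (e : V → ℕ) (c : Finset V → R) (B : Finset V) : R :=
  ∑ v ∈ Bᶜ, sg e v B * c (insert v B)

def HH (e : V → ℕ) (T : Finset V) (c : Finset V → R) (A : Finset V) : R :=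
  if A ⊆ T then ∑ v ∈ A, if (∀ t ∈ T, e v ≤ e t) then c (A.erase v) else 0 else 0

lemma sg_insert_lt (e : V → ℕ) {v u : V} {B : Finset V} (hu : u ∉ B) (h : e u < e v) :
    (sg e v (insert u B) : R) = - sg e v B := by
  unfold sg
  rw [Finset.filter_insert, if_pos h, Finset.card_insert_of_notMem (by simp [hu]), pow_succ]
  ring

lemma sg_insert_ge (e : V → ℕ) {v u : V} {B : Finset V} (h : ¬ e u < e v) :
    (sg e v (insert u B) : R) = sg e v B := by
  unfold sg
  rw [Finset.filter_insert, if_neg h]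

lemma DD_DD (e : V → ℕ) (he : Function.Injective e) (c : Finset V → R) (B : Finset V) :
    DD e (DD e c) B = 0 := by
  unfold DD
  simp_rw [Finset.mul_sum]
  rw [Finset.sum_sigma']
  refine Finset.sum_involution (fun x _ => ⟨x.2, x.1⟩) ?_ ?_ ?_ ?_
  · rintro ⟨v, u⟩ h
    simp only [Finset.mem_sigma, Finset.mem_compl, Finset.mem_insert, not_or] at h
    obtain ⟨hv, huv, hu⟩ := h
    rw [Finset.insert_comm u v]
    rcases lt_trichotomy (e u) (e v) with h | h | h
    · rw [sg_insert_ge e (v := u) (u := v) (by omega), sg_insert_lt e hu h]; ring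
    · exact absurd (he h) huv
    · rw [sg_insert_lt e hv h, sg_insert_ge e (v := v) (u := u) (by omega)]; ring
  · rintro ⟨v, u⟩ h _ h2
    simp only [Finset.mem_sigma, Finset.mem_compl, Finset.mem_insert, not_or] at h
    simp only [Sigma.mk.injEq] at h2
    exact h.2.1 h2.1
  · rintro ⟨v, u⟩ h
    simp only [Finset.mem_sigma, Finset.mem_compl, Finset.mem_insert, not_or] at h ⊢
    exact ⟨h.2.2, fun h' => h.2.1 h'.symm, h.1⟩
  · intros; rfl

lemma HH_eq (e : V → ℕ) (he : Function.Injective e) (T : Finset V) (c : Finset V → R)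
    (v0 : V) (h0 : v0 ∈ T) (hmin : ∀ t ∈ T, e v0 ≤ e t) (A : Finset V) :
    HH e T c A = if A ⊆ T ∧ v0 ∈ A then c (A.erase v0) else 0 := by
  unfold HH
  by_cases hA : A ⊆ T
  · simp only [hA, if_true, true_and]
    have : ∀ v ∈ A, (if (∀ t ∈ T, e v ≤ e t) then c (A.erase v) else 0) =
        if v = v0 then c (A.erase v) else 0 := by
      intro v hv
      have : (∀ t ∈ T, e v ≤ e t) ↔ v = v0 := by
        constructor
        · intro h; exact he (le_antisymm (h _ h0) (hmin _ (hA hv)))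
        · rintro rfl; exact hmin
      simp only [this]
    rw [Finset.sum_congr rfl this, Finset.sum_ite_eq']
  · simp [hA]

lemma DD_HH (e : V → ℕ) (he : Function.Injective e) (T : Finset V) (c : Finset V → R)
    (hc : ∀ A, ¬ A ⊆ T → c A = 0)
    (v0 : V) (h0 : v0 ∈ T) (hmin : ∀ t ∈ T, e v0 ≤ e t) (B : Finset V) (hB : B ⊆ T)
    (hD : v0 ∈ B → DD e c (B.erase v0) = 0) :
    DD e (HH e T c) B = c B := by
  unfold DD
  simp_rw [HH_eq e he T c v0 h0 hmin]
  by_cases hv : v0 ∈ B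
  · have h1 := hD hv
    unfold DD at h1
    have h2 : (B.erase v0)ᶜ = insert v0 Bᶜ := by
      ext x; by_cases hx : x = v0 <;> simp [hx]
    rw [h2, Finset.sum_insert (by simp [hv]), Finset.insert_erase hv] at h1
    have h3 : (sg e v0 (B.erase v0) : R) = 1 := by
      unfold sg
      rw [Finset.filter_eq_empty_iff.2]
      · simp
      · intro x hx
        have := hmin x (hB (Finset.mem_of_mem_erase hx))
        omega
    rw [h3, one_mul] at h1
    rw [eq_neg_of_add_eq_zero_left h1, ← Finset.sum_neg_distrib]
    refine Finset.sum_congr rfl fun v hvB => ?_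
    have hvB' : v ∉ B := by simpa using hvB
    have hne : v ≠ v0 := by rintro rfl; exact hvB' hv
    by_cases hT : v ∈ T
    · have hlt : e v0 < e v := lt_of_le_of_ne (hmin v hT) (fun h => hne (he h).symm)
      have h4 := sg_insert_lt (R := R) e (v := v) (Finset.notMem_erase v0 B) hlt
      rw [Finset.insert_erase hv] at h4
      rw [if_pos ⟨Finset.insert_subset hT hB, by simp [hv]⟩, h4,
        Finset.erase_insert_of_ne hne]
      ring
    · rw [if_neg (fun h => hT (h.1 (Finset.mem_insert_self _ _))), hc]
      · simp
      · intro h; exact hT (h (Finset.mem_insert_self _ _))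
  · rw [Finset.sum_eq_single v0]
    · rw [if_pos ⟨Finset.insert_subset h0 hB, by simp⟩, Finset.erase_insert hv]
      have h3 : (sg e v0 B : R) = 1 := by
        unfold sg
        rw [Finset.filter_eq_empty_iff.2]
        · simp
        · intro x hx
          have := hmin x (hB hx)
          omega
      rw [h3, one_mul]
    · intro v _ hne
      rw [if_neg, mul_zero]
      rintro ⟨_, h⟩
      simp [hv, hne.symm] at h
    · intro h; simp [hv] at h

def ep (e : V → ℕ) (A B : Finset V) : R :=
  ∑ v ∈ Bᶜ, if insert v B = A then sg e v B else 0

lemma ep_ne (e : V → ℕ) {A B : Finset V} (h : (ep e A B : R) ≠ 0) : B ⊆ A := by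
  obtain ⟨v, _, hv⟩ := Finset.exists_ne_zero_of_sum_ne_zero h
  have : insert v B = A := by by_contra h'; simp [h'] at hv
  rw [← this]; exact Finset.subset_insert _ _

lemma sum_ep (e : V → ℕ) (c : Finset V → R) (B : Finset V) :
    ∑ A : Finset V, ep e A B * c A = DD e c B := by
  unfold ep DD
  simp_rw [Finset.sum_mul]
  rw [Finset.sum_comm]
  refine Finset.sum_congr rfl fun v _ => ?_
  simp [ite_mul]

end chain
def Good (w : Vtx d m →₀ ℕ) : Prop :=
  ∀ (i : Fin d) (j k : Fin (m i)), j < k → w ⟨i, j.castSucc⟩ = 0 ∨ w ⟨i, k.castSucc⟩ = 0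

def TT (w : Vtx d m →₀ ℕ) : Finset (Var d m) :=
  Finset.univ.filter fun v => 1 ≤ w (emb v) ∧ 1 ≤ w ⟨v.1, Fin.last (m v.1)⟩

lemma single_add_le {α : Type*} {a b : α} (hab : a ≠ b) (w : α →₀ ℕ) :
    Finsupp.single a 1 + Finsupp.single b 1 ≤ w ↔ w a ≠ 0 ∧ w b ≠ 0 := by
  classical
  constructor
  · intro h
    have h1 := h a
    have h2 := h b
    simp [Finsupp.single_apply, hab, hab.symm] at h1 h2
    omega
  · rintro ⟨h1, h2⟩ x
    simp only [Finsupp.add_apply, Finsupp.single_apply]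
    by_cases hx : a = x
    · subst hx; simp [hab.symm]; omega
    · by_cases hy : b = x
      · subst hy; simp [hab]; omega
      · simp [hx, hy]

lemma mem_br (p : Pp d m K) :
    p ∈ brIdeal K ↔ ∀ w, Good w → MvPolynomial.coeff w p = 0 := by
  have h : (brIdeal K : Ideal (Pp d m K)) = Ideal.span ((fun s => MvPolynomial.monomial s (1 : K)) ''
      {s | ∃ (i : Fin d) (j k : Fin (m i)), j < k ∧
        s = Finsupp.single (⟨i, j.castSucc⟩ : Vtx d m) 1 +
          Finsupp.single (⟨i, k.castSucc⟩ : Vtx d m) 1}) := by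
    unfold brIdeal
    congr 1
    ext p
    constructor
    · rintro ⟨i, j, k, hjk, rfl⟩
      exact ⟨_, ⟨i, j, k, hjk, rfl⟩, by simp [MvPolynomial.X, MvPolynomial.monomial_mul]⟩
    · rintro ⟨_, ⟨i, j, k, hjk, rfl⟩, rfl⟩
      exact ⟨i, j, k, hjk, by simp [MvPolynomial.X, MvPolynomial.monomial_mul]⟩
  rw [h, MvPolynomial.mem_ideal_span_monomial_image]
  refine forall_congr' fun w => ?_
  rw [MvPolynomial.mem_support_iff, ← not_imp_not (b := Good w)]
  refine imp_congr_right fun _ => ?_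
  unfold Good
  push Not
  constructor
  · rintro ⟨_, ⟨i, j, k, hjk, rfl⟩, hle⟩
    refine ⟨i, j, k, hjk, (single_add_le ?_ w).1 hle⟩
    intro h
    simp at h
    exact hjk.ne h
  · rintro ⟨i, j, k, hjk, hle⟩
    refine ⟨_, ⟨i, j, k, hjk, rfl⟩, (single_add_le ?_ w).2 hle⟩
    intro h
    simp at h
    exact hjk.ne h

lemma mem_last (p : Pp d m K) :
    p ∈ lastIdeal K ↔ ∀ w, TT w = ∅ → MvPolynomial.coeff w p = 0 := by
  have h : (lastIdeal K : Ideal (Pp d m K)) =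
      Ideal.span ((fun s => MvPolynomial.monomial s (1 : K)) ''
      {s | ∃ (i : Fin d) (j : Fin (m i)),
        s = Finsupp.single (⟨i, Fin.last (m i)⟩ : Vtx d m) 1 +
          Finsupp.single (⟨i, j.castSucc⟩ : Vtx d m) 1}) := by
    unfold lastIdeal
    congr 1
    ext p
    constructor
    · rintro ⟨i, j, rfl⟩
      exact ⟨_, ⟨i, j, rfl⟩, by simp [MvPolynomial.X, MvPolynomial.monomial_mul]⟩
    · rintro ⟨_, ⟨i, j, rfl⟩, rfl⟩
      exact ⟨i, j, by simp [MvPolynomial.X, MvPolynomial.monomial_mul]⟩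
  have hne : ∀ (i : Fin d) (j : Fin (m i)),
      (⟨i, Fin.last (m i)⟩ : Vtx d m) ≠ ⟨i, j.castSucc⟩ := by
    intro i j h
    simp at h
    exact (Fin.castSucc_lt_last j).ne h.symm
  rw [h, MvPolynomial.mem_ideal_span_monomial_image]
  refine forall_congr' fun w => ?_
  rw [MvPolynomial.mem_support_iff, ← not_imp_not (b := TT w = ∅)]
  refine imp_congr_right fun _ => ?_
  rw [← ne_eq, ← Finset.nonempty_iff_ne_empty]
  constructor
  · rintro ⟨_, ⟨i, j, rfl⟩, hle⟩
    have := (single_add_le (hne i j) w).1 hle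
    refine ⟨⟨i, j⟩, ?_⟩
    refine Finset.mem_filter.2 ⟨Finset.mem_univ _, ?_, ?_⟩
    · exact Nat.one_le_iff_ne_zero.2 this.2
    · exact Nat.one_le_iff_ne_zero.2 this.1
  · rintro ⟨⟨i, j⟩, hij⟩
    have h2 := (Finset.mem_filter.1 hij).2
    exact ⟨_, ⟨i, j, rfl⟩, (single_add_le (hne i j) w).2
      ⟨Nat.one_le_iff_ne_zero.1 h2.2, Nat.one_le_iff_ne_zero.1 h2.1⟩⟩

lemma emb_inj : Function.Injective (emb : Var d m → Vtx d m) := by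
  rintro ⟨i, j⟩ ⟨i', j'⟩ h
  simp only [emb, Sigma.mk.injEq] at h
  obtain ⟨rfl, h⟩ := h
  simp at h
  rw [h]

lemma last_ne_emb (i : Fin d) (v : Var d m) : (⟨i, Fin.last (m i)⟩ : Vtx d m) ≠ emb v := by
  obtain ⟨i', j⟩ := v
  intro h
  simp only [emb, Sigma.mk.injEq] at h
  obtain ⟨rfl, h⟩ := h
  simp at h
  exact (Fin.castSucc_lt_last j).ne h.symm

lemma shift_emb (A : Finset (Var d m)) (v : Var d m) :
    shiftDeg A (emb v) = (∑ a ∈ A, Finsupp.single (emb a) 1 : Vtx d m →₀ ℕ) (emb v) := by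
  unfold shiftDeg
  rw [Finset.sum_add_distrib, Finsupp.add_apply, Finsupp.finsetSum_apply,
    Finsupp.finsetSum_apply, Nat.add_eq_left]
  refine Finset.sum_eq_zero fun a _ => ?_
  rw [Finsupp.single_apply, if_neg (last_ne_emb _ _)]

lemma shift_emb' (A : Finset (Var d m)) (v : Var d m) :
    shiftDeg A (emb v) = if v ∈ A then 1 else 0 := by
  rw [shift_emb, Finsupp.finsetSum_apply]
  simp [Finsupp.single_apply, emb_inj.eq_iff]

lemma shift_last (A : Finset (Var d m)) (i : Fin d) :
    shiftDeg A ⟨i, Fin.last (m i)⟩ = (A.filter fun v => v.1 = i).card := by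
  unfold shiftDeg
  rw [Finset.sum_add_distrib, Finsupp.add_apply, Finsupp.finsetSum_apply,
    Finsupp.finsetSum_apply, Finset.sum_eq_zero, zero_add, Finset.card_filter]
  · refine Finset.sum_congr rfl fun a _ => ?_
    rw [Finsupp.single_apply]
    by_cases h : a.1 = i
    · subst h; simp
    · rw [if_neg h, if_neg]
      intro h'
      exact h (congrArg Sigma.fst h')
  · intro a _
    rw [Finsupp.single_apply, if_neg (last_ne_emb _ _).symm]

lemma le_TT {A : Finset (Var d m)} (hA : CSFSet A) (w : Vtx d m →₀ ℕ) :
    shiftDeg A ≤ w ↔ A ⊆ TT w := by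
  constructor
  · intro h v hv
    simp only [TT, Finset.mem_filter, Finset.mem_univ, true_and]
    have h1 := h (emb v)
    have h2 := h ⟨v.1, Fin.last (m v.1)⟩
    rw [shift_emb', if_pos hv] at h1
    rw [shift_last] at h2
    have : 0 < (A.filter fun a => a.1 = v.1).card := Finset.card_pos.2 ⟨v, by simp [hv]⟩
    omega
  · intro h x
    obtain ⟨i, j⟩ := x
    induction j using Fin.lastCases with
    | last =>
      rw [shift_last]
      rcases (A.filter fun v => v.1 = i).eq_empty_or_nonempty with h0 | ⟨v, hv⟩
      · simp [h0]
      · have hle : (A.filter fun v => v.1 = i).card ≤ 1 := by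
          rw [Finset.card_le_one]
          intro a ha b hb
          simp only [Finset.mem_filter] at ha hb
          exact hA a ha.1 b hb.1 (ha.2.trans hb.2.symm)
        simp only [Finset.mem_filter] at hv
        have := h hv.1
        simp only [TT, Finset.mem_filter, Finset.mem_univ, true_and] at this
        obtain ⟨hv, rfl⟩ := hv
        omega
    | cast j =>
      have h1 := shift_emb' A ⟨i, j⟩
      simp only [emb] at h1
      rw [h1]
      split_ifs with hij
      · have := h hij
        simp only [TT, Finset.mem_filter, Finset.mem_univ, true_and] at this
        exact this.1
      · exact Nat.zero_le _

lemma csf_of_good {w : Vtx d m →₀ ℕ} (hw : Good w) {A : Finset (Var d m)} (hA : A ⊆ TT w) :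
    CSFSet A := by
  rintro ⟨i, j⟩ hv ⟨i', k⟩ hu h
  simp only at h
  subst h
  have h1 := hA hv
  have h2 := hA hu
  simp only [TT, Finset.mem_filter, Finset.mem_univ, true_and] at h1 h2
  have h1' : 1 ≤ w ⟨i, j.castSucc⟩ := h1.1
  have h2' : 1 ≤ w ⟨i, k.castSucc⟩ := h2.1
  rcases lt_trichotomy j k with h | h | h
  · have := hw i j k h; omega
  · rw [h]
  · have := hw i k j h; omega

def CC (A : Finset (Var d m)) (p : Pp d m K) (w : Vtx d m →₀ ℕ) : K :=
  MvPolynomial.coeff w (MvPolynomial.monomial (shiftDeg A) 1 * p)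

lemma good_congr {w w' : Vtx d m →₀ ℕ} (h : ∀ v : Var d m, w (emb v) = w' (emb v)) :
    Good w ↔ Good w' := by
  unfold Good
  refine forall_congr' fun i => forall_congr' fun j => forall_congr' fun k => ?_
  have h1 := h ⟨i, j⟩
  have h2 := h ⟨i, k⟩
  simp only [emb] at h1 h2
  rw [h1, h2]

lemma mem_colonOf (A : Finset (Var d m)) (p : Pp d m K) :
    p ∈ colonOf K (brIdeal K) A ↔ ∀ w, Good w → CC K A p w = 0 := by
  unfold colonOf
  rw [Ideal.mem_colon_span_singleton, mem_br]
  unfold monA CC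
  have key : ∀ μ : Vtx d m →₀ ℕ, Good (shiftDeg A + μ) ↔
      Good (μ + ∑ v ∈ A, Finsupp.single (emb v) 1) := by
    intro μ
    refine good_congr fun v => ?_
    rw [Finsupp.add_apply, Finsupp.add_apply, shift_emb, add_comm]
  constructor
  · intro h w hw
    rw [MvPolynomial.coeff_monomial_mul']
    split_ifs with hle
    · have h1 := h ((w - shiftDeg A) + ∑ v ∈ A, Finsupp.single (emb v) 1)
        ((key _).1 (by rwa [add_tsub_cancel_of_le hle]))
      rw [MvPolynomial.coeff_mul_monomial] at h1
      rw [one_mul]; simpa using h1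
    · rfl
  · intro h w hw
    rw [MvPolynomial.coeff_mul_monomial']
    split_ifs with hle
    · have h1 := h (shiftDeg A + (w - ∑ v ∈ A, Finsupp.single (emb v) 1))
        ((key _).2 (by rwa [tsub_add_cancel_of_le hle]))
      rw [MvPolynomial.coeff_monomial_mul] at h1
      rw [mul_one]; simpa using h1
    · rfl

lemma mem_sup (p : Pp d m K) :
    p ∈ brIdeal K ⊔ lastIdeal K ↔
      ∀ w, Good w → TT w = ∅ → MvPolynomial.coeff w p = 0 := by
  classical
  constructor
  · intro h w hw hT
    obtain ⟨a, ha, b, hb, rfl⟩ := Submodule.mem_sup.1 h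
    rw [MvPolynomial.coeff_add, (mem_br K a).1 ha w hw, (mem_last K b).1 hb w hT, add_zero]
  · intro h
    rw [p.as_sum]
    refine Ideal.sum_mem _ fun w hwp => ?_
    rw [MvPolynomial.mem_support_iff] at hwp
    by_cases hw : Good w
    · refine Ideal.mem_sup_right ((mem_last K _).2 fun w' hw' => ?_)
      rw [MvPolynomial.coeff_monomial, if_neg]
      rintro rfl
      exact hwp (h _ hw hw')
    · refine Ideal.mem_sup_left ((mem_br K _).2 fun w' hw' => ?_)
      rw [MvPolynomial.coeff_monomial, if_neg]
      rintro rfl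
      exact hw hw'
def ee (v : Var d m) : ℕ := (Fintype.equivFin (Var d m) v : ℕ)

lemma ee_inj : Function.Injective (ee : Var d m → ℕ) := by
  intro a b h
  exact (Fintype.equivFin (Var d m)).injective (Fin.ext h)

open Classical in
def ext {k : ℕ} (p : CSFk d m k → Pp d m K) (w : Vtx d m →₀ ℕ) (A : Finset (Var d m)) : K :=
  if h : CSFSet A ∧ A.card = k then CC K A (p ⟨A, h⟩) w else 0

lemma ext_coe {k : ℕ} (p : CSFk d m k → Pp d m K) (w : Vtx d m →₀ ℕ) (A : CSFk d m k) :
    ext K p w A.1 = CC K A.1 (p A) w := by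
  unfold ext
  rw [dif_pos A.2]

lemma ext_neg {k : ℕ} (p : CSFk d m k → Pp d m K) (w : Vtx d m →₀ ℕ) (A : Finset (Var d m))
    (h : ¬ (CSFSet A ∧ A.card = k)) : ext K p w A = 0 := by
  unfold ext
  rw [dif_neg h]

lemma ext_zero {k : ℕ} (p : CSFk d m k → Pp d m K) (w : Vtx d m →₀ ℕ) (A : Finset (Var d m))
    (h : ¬ A ⊆ TT w) : ext K p w A = 0 := by
  unfold ext
  split_ifs with hA
  · unfold CC
    rw [MvPolynomial.coeff_monomial_mul', if_neg]
    rwa [le_TT hA.1]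
  · rfl

lemma shift_mono {A B : Finset (Var d m)} (h : B ⊆ A) : shiftDeg B ≤ shiftDeg A :=
  Finset.sum_le_sum_of_subset h

def cof (A B : Finset (Var d m)) : Pp d m K :=
  MvPolynomial.monomial (shiftDeg A - shiftDeg B) (ep ee A B)

lemma cof_mul (A B : Finset (Var d m)) :
    MvPolynomial.monomial (shiftDeg B) 1 * cof K A B =
      MvPolynomial.C (ep ee A B) * MvPolynomial.monomial (shiftDeg A) 1 := by
  unfold cof
  by_cases h : (ep ee A B : K) = 0
  · simp [h]
  · rw [MvPolynomial.monomial_mul, add_tsub_cancel_of_le (shift_mono (ep_ne ee h)),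
      MvPolynomial.C_mul_monomial, one_mul, mul_one]

lemma CC_cof (A B : Finset (Var d m)) (p : Pp d m K) (w : Vtx d m →₀ ℕ) :
    CC K B (cof K A B * p) w = ep ee A B * CC K A p w := by
  unfold CC
  rw [← mul_assoc, cof_mul, mul_assoc, MvPolynomial.coeff_C_mul]

def fAB (A B : Finset (Var d m)) :
    (Pp d m K ⧸ colonOf K (brIdeal K) A) →ₗ[Pp d m K] (Pp d m K ⧸ colonOf K (brIdeal K) B) :=
  Submodule.mapQ _ _ (LinearMap.mulLeft (Pp d m K) (cof K A B)) (by
    intro r hr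
    rw [mem_colonOf] at hr
    rw [Submodule.mem_comap, LinearMap.mulLeft_apply, mem_colonOf]
    intro w hw
    rw [CC_cof, hr w hw, mul_zero])

open Classical in
def ff (k : ℕ) : FmodC (d := d) (m := m) K (brIdeal K) (k + 1) →ₗ[Pp d m K]
    FmodC (d := d) (m := m) K (brIdeal K) k :=
  LinearMap.pi fun B => ∑ A : CSFk d m (k + 1), (fAB K A.1 B.1) ∘ₗ LinearMap.proj A

def gg : FmodC (d := d) (m := m) K (brIdeal K) 0 →ₗ[Pp d m K]
    Pp d m K ⧸ (brIdeal K ⊔ lastIdeal K : Ideal (Pp d m K)) :=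
  (Submodule.mapQ (colonOf K (brIdeal K) ∅) _ LinearMap.id (by
    intro r hr
    rw [mem_colonOf] at hr
    rw [Submodule.mem_comap, LinearMap.id_apply, mem_sup]
    intro w hw _
    simpa [CC, shiftDeg] using hr w hw)) ∘ₗ
    LinearMap.proj (φ := fun B : CSFk d m 0 => Pp d m K ⧸ colonOf K (brIdeal K) B.1)
      ⟨∅, by simp [CSFSet], rfl⟩

def qq {k : ℕ} (p : CSFk d m k → Pp d m K) : FmodC (d := d) (m := m) K (brIdeal K) k :=
  fun A => Submodule.Quotient.mk (p A)

lemma qq_surj {k : ℕ} (x : FmodC (d := d) (m := m) K (brIdeal K) k) : ∃ p, x = qq K p := by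
  choose p hp using fun A => Submodule.Quotient.mk_surjective _ (x A)
  exact ⟨p, funext fun A => (hp A).symm⟩

lemma CC_sub (A : Finset (Var d m)) (p q : Pp d m K) (w : Vtx d m →₀ ℕ) :
    CC K A (p - q) w = CC K A p w - CC K A q w := by
  unfold CC
  rw [mul_sub, MvPolynomial.coeff_sub]

lemma qq_eq {k : ℕ} (p q : CSFk d m k → Pp d m K) :
    qq K p = qq K q ↔ ∀ w, Good w → ∀ A : CSFk d m k, CC K A.1 (p A) w = CC K A.1 (q A) w := by
  rw [funext_iff]
  unfold qq
  simp_rw [Submodule.Quotient.eq, mem_colonOf, CC_sub, sub_eq_zero]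
  exact ⟨fun h w hw A => h A w hw, fun h A w hw => h w hw A⟩

lemma qq_zero {k : ℕ} (p : CSFk d m k → Pp d m K) :
    qq K p = 0 ↔ ∀ w, Good w → ∀ A : CSFk d m k, CC K A.1 (p A) w = 0 := by
  have : (0 : FmodC (d := d) (m := m) K (brIdeal K) k) = qq K 0 := rfl
  rw [this, qq_eq]
  simp [CC]

open Classical in
def pf {k : ℕ} (p : CSFk d m (k + 1) → Pp d m K) : CSFk d m k → Pp d m K :=
  fun B => ∑ A : CSFk d m (k + 1), cof K A.1 B.1 * p A

lemma ff_qq {k : ℕ} (p : CSFk d m (k + 1) → Pp d m K) : ff K k (qq K p) = qq K (pf K p) := by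
  classical
  funext B
  unfold ff qq pf
  rw [LinearMap.pi_apply, LinearMap.sum_apply, ← Submodule.mkQ_apply, map_sum]
  rfl

lemma csf_mono {A B : Finset (Var d m)} (h : B ⊆ A) (hA : CSFSet A) : CSFSet B :=
  fun v hv u hu => hA v (h hv) u (h hu)

lemma CC_pf {k : ℕ} (p : CSFk d m (k + 1) → Pp d m K) (B : CSFk d m k) (w : Vtx d m →₀ ℕ) :
    CC K B.1 (pf K p B) w = DD ee (ext K p w) B.1 := by
  classical
  have h1 : CC K B.1 (pf K p B) w = ∑ A : CSFk d m (k + 1), ep ee A.1 B.1 * ext K p w A.1 := by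
    simp_rw [ext_coe, ← CC_cof]
    unfold pf CC
    rw [Finset.mul_sum, MvPolynomial.coeff_sum]
  rw [h1, ← sum_ep]
  rw [← Finset.sum_subtype (p := fun A => CSFSet A ∧ A.card = k + 1)
    (Finset.univ.filter fun A => CSFSet A ∧ A.card = k + 1) (by simp)
    (fun A => ep ee A B.1 * ext K p w A)]
  rw [Finset.sum_filter]
  refine Finset.sum_congr rfl fun A _ => ?_
  split_ifs with h
  · rfl
  · unfold ext; rw [dif_neg h, mul_zero]

lemma ext_pf {k : ℕ} (p : CSFk d m (k + 1) → Pp d m K) (w : Vtx d m →₀ ℕ) :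
    ext K (pf K p) w = DD ee (ext K p w) := by
  funext B
  by_cases hB : CSFSet B ∧ B.card = k
  · exact (ext_coe K (pf K p) w ⟨B, hB⟩).trans (CC_pf K p ⟨B, hB⟩ w)
  · rw [ext_neg K _ w B hB]
    symm
    refine Finset.sum_eq_zero fun v hv => ?_
    rw [ext_neg, mul_zero]
    rintro ⟨h1, h2⟩
    rw [Finset.card_insert_of_notMem (by simpa using hv)] at h2
    exact hB ⟨csf_mono (Finset.subset_insert _ _) h1, by omega⟩

open Classical in
def filt (S : (Vtx d m →₀ ℕ) → Prop) (p : Pp d m K) : Pp d m K :=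
  ∑ w ∈ p.support.filter S, MvPolynomial.monomial w (MvPolynomial.coeff w p)

open Classical in
lemma coeff_filt (S : (Vtx d m →₀ ℕ) → Prop) (p : Pp d m K) (w : Vtx d m →₀ ℕ) :
    MvPolynomial.coeff w (filt K S p) = if S w then MvPolynomial.coeff w p else 0 := by
  unfold filt
  rw [MvPolynomial.coeff_sum]
  simp_rw [MvPolynomial.coeff_monomial]
  rw [Finset.sum_ite_eq']
  simp only [Finset.mem_filter, MvPolynomial.mem_support_iff]
  by_cases h1 : S w <;> by_cases h2 : MvPolynomial.coeff w p = 0 <;> simp [h1, h2]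

lemma erase_csf {k : ℕ} (A : CSFk d m (k + 1)) (v : A.1) :
    CSFSet (A.1.erase v.1) ∧ (A.1.erase v.1).card = k :=
  ⟨csf_mono (Finset.erase_subset _ _) A.2.1, by
    rw [Finset.card_erase_of_mem v.2, A.2.2]; rfl⟩

def hom {k : ℕ} (p : CSFk d m k → Pp d m K) : CSFk d m (k + 1) → Pp d m K := fun A =>
  MvPolynomial.divMonomial (∑ v : A.1, filt K (fun w => ∀ t ∈ TT w, ee v.1 ≤ ee t)
    (MvPolynomial.monomial (shiftDeg (A.1.erase v.1)) 1 * p ⟨A.1.erase v.1, erase_csf A v⟩))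
    (shiftDeg A.1)

lemma ext_hom {k : ℕ} (p : CSFk d m k → Pp d m K) (w : Vtx d m →₀ ℕ) (hw : Good w) :
    ext K (hom K p) w = HH ee (TT w) (ext K p w) := by
  classical
  funext A
  by_cases hT : A ⊆ TT w
  · unfold HH
    rw [if_pos hT]
    by_cases hA : CSFSet A ∧ A.card = k + 1
    · refine (ext_coe K (hom K p) w ⟨A, hA⟩).trans ?_
      unfold CC hom
      rw [MvPolynomial.coeff_monomial_mul', if_pos ((le_TT hA.1 w).2 hT), one_mul,
        MvPolynomial.coeff_divMonomial, add_tsub_cancel_of_le ((le_TT hA.1 w).2 hT),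
        MvPolynomial.coeff_sum, ← Finset.sum_coe_sort A]
      refine Finset.sum_congr rfl fun v _ => ?_
      rw [coeff_filt]
      have := ext_coe K p w ⟨A.erase v.1, erase_csf ⟨A, hA⟩ v⟩
      simp only at this
      rw [this]
      simp only [CC]
    · unfold ext
      rw [dif_neg hA]
      symm
      refine Finset.sum_eq_zero fun v hv => ?_
      rw [dif_neg]
      · simp
      · rintro ⟨_, h2⟩
        rw [Finset.card_erase_of_mem hv] at h2
        have : 0 < A.card := Finset.card_pos.2 ⟨v, hv⟩
        exact hA ⟨csf_of_good hw hT, by omega⟩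
  · rw [ext_zero K _ w A hT]
    unfold HH
    rw [if_neg hT]

lemma main_hom {k : ℕ} (p : CSFk d m k → Pp d m K)
    (hp : ∀ w, Good w → ∀ B : CSFk d m k, TT w = ∅ → CC K B.1 (p B) w = 0)
    (hp2 : ∀ w, Good w → ∀ (B : Finset (Var d m)), ∀ v ∈ B,
      DD ee (ext K p w) (B.erase v) = 0) :
    ff K k (qq K (hom K p)) = qq K p := by
  rw [ff_qq, qq_eq]
  intro w hw B
  rw [CC_pf, ← ext_coe, ext_hom K p w hw]
  rcases (TT w).eq_empty_or_nonempty with hT | hT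
  · rw [ext_coe, hp w hw B hT]
    refine Finset.sum_eq_zero fun v _ => ?_
    unfold HH
    rw [if_neg, mul_zero]
    rw [hT]
    intro h
    simpa using h (Finset.mem_insert_self _ _)
  · obtain ⟨v0, h0, hmin⟩ := Finset.exists_min_image (TT w) ee hT
    by_cases hB : B.1 ⊆ TT w
    · exact DD_HH ee ee_inj (TT w) _ (fun A hA => ext_zero K p w A hA) v0 h0 hmin B.1 hB
        (fun h => hp2 w hw B.1 v0 h)
    · rw [ext_zero K p w _ hB]
      refine Finset.sum_eq_zero fun v _ => ?_
      unfold HH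
      rw [if_neg, mul_zero]
      intro h
      exact hB ((Finset.subset_insert _ _).trans h)

/-- Proposition `prop:key exact sequence`.  For the ideal
`I = 𝔪_1^{[2]} + ⋯ + 𝔪_d^{[2]}` of `P' = P(d, m+(1,…,1))` there is an exact sequence of
`ℤ^{d+|m|}`-graded `P'`-modules
`0 → F_d → ⋯ → F_1 → F_0 = P'/I → P'/(I + Σ_i x_{i,m_i+1}·𝔪_i) → 0`, where
`F_k = ⊕_{u ∈ [Mon_cs(P)]_k} (P'/(I : u))(-deg(u·∏_{i ∈ cSupp u} x_{i,m_i+1}))`.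
(The modules `F_k` vanish for `k > d`, so exactness at every spot includes injectivity of
`F_d → F_{d-1}`; gradedness is expressed componentwise.) -/
theorem statement_16 (d : ℕ) (m : Fin d → ℕ) (K : Type*) [Field K] :
    ∃ (f : ∀ k : ℕ, FmodC K (brIdeal K) (k + 1) →ₗ[Pp d m K] FmodC K (brIdeal K) k)
      (g : FmodC K (brIdeal K) 0 →ₗ[Pp d m K] Pp d m K ⧸ (brIdeal K ⊔ lastIdeal K)),
      Function.Surjective g ∧
      (∀ A : CSFk d m 0,
        GradedBetween K (colonOf K (brIdeal K) A.1) (brIdeal K ⊔ lastIdeal K)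
          (shiftDeg A.1) 0
          (g ∘ₗ LinearMap.single (Pp d m K)
            (fun B : CSFk d m 0 => Pp d m K ⧸ colonOf K (brIdeal K) B.1) A)) ∧
      (∀ (k : ℕ) (A : CSFk d m (k + 1)) (B : CSFk d m k),
        GradedBetween K (colonOf K (brIdeal K) A.1) (colonOf K (brIdeal K) B.1)
          (shiftDeg A.1) (shiftDeg B.1) (piComp (f k) A B)) ∧
      (LinearMap.ker g = LinearMap.range (f 0)) ∧
      (∀ k : ℕ, LinearMap.ker (f k) = LinearMap.range (f (k + 1))) := by
  classical
  have hgq : ∀ p : CSFk d m 0 → Pp d m K,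
      gg K (qq K p) = Submodule.Quotient.mk (p ⟨∅, by simp [CSFSet], rfl⟩) := fun p => rfl
  have hemp : ∀ A : CSFk d m 0, A = ⟨∅, by simp [CSFSet], rfl⟩ := fun A =>
    Subtype.ext (Finset.card_eq_zero.1 A.2.2)
  have hCC0 : ∀ (p : Pp d m K) w, CC K ∅ p w = MvPolynomial.coeff w p := by
    intro p w; simp [CC, shiftDeg]
  refine ⟨ff K, gg K, ?_, ?_, ?_, ?_, ?_⟩
  · intro y
    obtain ⟨y, rfl⟩ := Submodule.Quotient.mk_surjective _ y
    exact ⟨qq K (fun _ => y), hgq _⟩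
  · intro A
    obtain rfl := hemp A
    refine ⟨1, ?_, ?_⟩
    · intro μ hμ
      rw [MvPolynomial.coeff_one] at hμ
      have : μ = 0 := by by_contra h; exact hμ (if_neg (fun h' => h h'.symm))
      simp [this, shiftDeg]
    · intro x
      rw [one_mul, LinearMap.comp_apply]
      unfold gg
      rw [LinearMap.comp_apply, LinearMap.proj_apply, LinearMap.single_apply, Pi.single_eq_same]
      rfl
  · intro k A B
    refine ⟨cof K A.1 B.1, ?_, ?_⟩
    · intro μ hμ
      unfold cof at hμ
      rw [MvPolynomial.coeff_monomial] at hμ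
      split_ifs at hμ with h
      · rw [← h, tsub_add_cancel_of_le (shift_mono (ep_ne ee hμ))]
      · exact absurd rfl hμ
    · intro x
      unfold piComp ff
      rw [LinearMap.comp_apply, LinearMap.comp_apply, LinearMap.proj_apply, LinearMap.pi_apply,
        LinearMap.sum_apply, Finset.sum_eq_single A]
      · rw [LinearMap.comp_apply, LinearMap.proj_apply, LinearMap.single_apply,
          Pi.single_eq_same]
        rfl
      · intro A' _ hne
        rw [LinearMap.comp_apply, LinearMap.proj_apply, LinearMap.single_apply,
          Pi.single_eq_of_ne hne, map_zero]
      · simp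
  · ext x
    rw [LinearMap.mem_ker, LinearMap.mem_range]
    constructor
    · intro h
      obtain ⟨p, rfl⟩ := qq_surj K x
      refine ⟨qq K (hom K p), main_hom K p ?_ ?_⟩
      · intro w hw B hT
        obtain rfl := hemp B
        rw [hgq, Submodule.Quotient.mk_eq_zero, mem_sup] at h
        rw [hCC0]
        exact h w hw hT
      · intro w hw B v _
        refine Finset.sum_eq_zero fun u _ => ?_
        unfold ext
        rw [dif_neg, mul_zero]
        rintro ⟨_, h2⟩
        rw [Finset.card_eq_zero] at h2
        exact Finset.insert_ne_empty _ _ h2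
    · rintro ⟨y, rfl⟩
      obtain ⟨p, rfl⟩ := qq_surj K y
      rw [ff_qq, hgq, Submodule.Quotient.mk_eq_zero, mem_sup]
      intro w hw hT
      rw [← hCC0, CC_pf K p ⟨∅, by simp [CSFSet], rfl⟩ w]
      refine Finset.sum_eq_zero fun u _ => ?_
      rw [ext_zero, mul_zero]
      rw [hT]
      intro h
      simpa using h (Finset.mem_insert_self _ _)
  · intro k
    ext x
    rw [LinearMap.mem_ker, LinearMap.mem_range]
    constructor
    · intro h
      obtain ⟨p, rfl⟩ := qq_surj K x
      refine ⟨qq K (hom K p), main_hom K p ?_ ?_⟩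
      · intro w hw B hT
        rw [← ext_coe]
        refine ext_zero K p w _ ?_
        rw [hT, Finset.subset_empty]
        intro h0
        have := B.2.2
        rw [h0] at this
        simp at this
      · intro w hw B v _
        rw [ff_qq, qq_zero] at h
        rw [← ext_pf]
        unfold ext
        split_ifs with hB
        · exact h w hw ⟨_, hB⟩
        · rfl
    · rintro ⟨y, rfl⟩
      obtain ⟨p, rfl⟩ := qq_surj K y
      rw [ff_qq, ff_qq, qq_zero]
      intro w hw B
      rw [CC_pf, ext_pf]
      exact DD_DD ee ee_inj _ _

end BalSq
end
end
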